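/- arXiv:2504.16241 — 2 statements merged into one kernel-verified Lean document; each statement's English description precedes it below -/
import Mathlib

section
/- Let R be a commutative ring, a, b ∈ R, and A = R[x]/⟨x² + ax + b⟩. Then A is étale over R (i.e. formally étale and of finite presentation) if and only if a² − 4b is a unit in R. -/
open Polynomial

lemma aux_monic (R : Type*) [CommRing R] (a b : R) :
    (X ^ 2 + C a * X + C b : R[X]).Monic := by
  monicity!

lemma aux_pair {R : Type*} [CommRing R] (P : StandardEtalePair R) (hg : IsUnit P.g) :
    Algebra.Etale R (AdjoinRoot P.f) := by
  have h1 : P.HasMap (AdjoinRoot.root P.f) :=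
    ⟨by rw [AdjoinRoot.aeval_eq, AdjoinRoot.mk_self], hg.map _⟩
  let u := P.lift _ h1
  let w := AdjoinRoot.liftAlgHom _ (Algebra.ofId R P.Ring) P.X P.hasMap_X.1
  have hu : u P.X = AdjoinRoot.root P.f := P.lift_X _ h1
  have hw : w (AdjoinRoot.root P.f) = P.X := AdjoinRoot.liftAlgHom_root ..
  let e : P.Ring ≃ₐ[R] AdjoinRoot P.f := AlgEquiv.ofAlgHom u w
    (AdjoinRoot.algHom_ext (by rw [AlgHom.comp_apply, hw, hu, AlgHom.id_apply]))
    (P.hom_ext (by rw [AlgHom.comp_apply, hu, hw, AlgHom.id_apply]))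
  have : Algebra.Etale R P.Ring := inferInstance
  exact Algebra.Etale.of_equiv e

lemma aux_back (R : Type*) [CommRing R] (a b : R) (h : IsUnit (a ^ 2 - 4 * b)) :
    Algebra.Etale R (AdjoinRoot (X ^ 2 + C a * X + C b)) := by
  obtain ⟨v, hv⟩ := h.exists_right_inv
  have hv' : (C a ^ 2 - 4 * C b) * C v = (1 : R[X]) := by
    have := congrArg (C : R → R[X]) hv
    rw [map_mul, map_sub, map_mul, map_pow, map_one, map_ofNat] at this
    exact this
  let P : StandardEtalePair R :=
    { f := X ^ 2 + C a * X + C b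
      monic_f := aux_monic R a b
      g := 1
      cond := ⟨C v * (2 * X + C a), -4 * C v, 0, by
        have : derivative (X ^ 2 + C a * X + C b : R[X]) = 2 * X + C a := by
          simp; norm_num
        rw [this]
        linear_combination hv'⟩ }
  exact aux_pair P isUnit_one

lemma aux_root (R : Type*) [CommRing R] (a b : R) (S : Type*) [CommRing S] [Algebra R S] (y : S)
    (hy : y ^ 2 + algebraMap R S a * y + algebraMap R S b = 0) :
    eval₂ (Algebra.ofId R S : R →+* S) y (X ^ 2 + C a * X + C b) = 0 := by
  rw [eval₂_add, eval₂_add, eval₂_mul, eval₂_pow, eval₂_X, eval₂_C, eval₂_C]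
  exact hy

lemma aux_triv (R : Type*) [CommRing R] (a b : R)
    (h : Algebra.FormallyUnramified R (AdjoinRoot (X ^ 2 + C a * X + C b)))
    (Q : Type*) [CommRing Q] [Algebra R Q] (y : Q)
    (hy : y ^ 2 + algebraMap R Q a * y + algebraMap R Q b = 0)
    (hy2 : 2 * y + algebraMap R Q a = 0) : (0 : Q) = 1 := by
  have h1 : (TrivSqZeroExt.inl y : TrivSqZeroExt Q Q) ^ 2
      + algebraMap R _ a * TrivSqZeroExt.inl y + algebraMap R _ b = 0 := by
    ext
    · simpa [TrivSqZeroExt.algebraMap_eq_inl'] using hy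
    · simp [TrivSqZeroExt.algebraMap_eq_inl']
  have h2 : (TrivSqZeroExt.inl y + TrivSqZeroExt.inr 1 : TrivSqZeroExt Q Q) ^ 2
      + algebraMap R _ a * (TrivSqZeroExt.inl y + TrivSqZeroExt.inr 1) + algebraMap R _ b = 0 := by
    ext
    · simpa [TrivSqZeroExt.algebraMap_eq_inl'] using hy
    · simpa [TrivSqZeroExt.algebraMap_eq_inl', pow_two, two_mul] using hy2
  let g₁ := AdjoinRoot.liftAlgHom _ (Algebra.ofId R (TrivSqZeroExt Q Q)) _ (aux_root R a b _ _ h1)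
  let g₂ := AdjoinRoot.liftAlgHom _ (Algebra.ofId R (TrivSqZeroExt Q Q)) _ (aux_root R a b _ _ h2)
  have e₁ : g₁ (AdjoinRoot.root _) = TrivSqZeroExt.inl y := AdjoinRoot.liftAlgHom_root ..
  have e₂ : g₂ (AdjoinRoot.root _) = TrivSqZeroExt.inl y + TrivSqZeroExt.inr 1 :=
    AdjoinRoot.liftAlgHom_root ..
  have hg : g₁ = g₂ := by
    refine Algebra.FormallyUnramified.lift_unique' (TrivSqZeroExt.fstHom R Q Q) ?_ g₁ g₂ ?_
    · refine ⟨2, ?_⟩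
      rw [pow_two, Ideal.zero_eq_bot, eq_bot_iff, Ideal.mul_le]
      intro r hr s hs
      have hr' : r.fst = 0 := hr
      have hs' : s.fst = 0 := hs
      rw [Ideal.mem_bot]
      ext <;> simp [hr', hs']
    · apply AdjoinRoot.algHom_ext
      rw [AlgHom.comp_apply, AlgHom.comp_apply, e₁, e₂]
      simp
  have := congrArg TrivSqZeroExt.snd (e₁.symm.trans ((DFunLike.congr_fun hg _).trans e₂))
  simpa using this

lemma aux_forw (R : Type*) [CommRing R] (a b : R)
    (h : Algebra.FormallyUnramified R (AdjoinRoot (X ^ 2 + C a * X + C b))) :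
    IsUnit (a ^ 2 - 4 * b) := by
  set f : R[X] := X ^ 2 + C a * X + C b with hf
  have hm : f.Monic := aux_monic R a b
  rcases subsingleton_or_nontrivial R with hR | hR
  · exact isUnit_of_subsingleton _
  let x := AdjoinRoot.root f
  have hx : x ^ 2 + algebraMap R _ a * x + algebraMap R _ b = 0 := by
    have : aeval x f = 0 := by rw [AdjoinRoot.aeval_eq, AdjoinRoot.mk_self]
    simpa [hf] using this
  let I : Ideal (AdjoinRoot f) := Ideal.span {2 * x + algebraMap R _ a}
  let Q := AdjoinRoot f ⧸ I
  let y : Q := Ideal.Quotient.mk I x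
  have hy : y ^ 2 + algebraMap R Q a * y + algebraMap R Q b = 0 := by
    have := congrArg (Ideal.Quotient.mk I) hx
    rw [map_add, map_add, map_mul, map_pow, map_zero] at this
    exact this
  have hy2 : 2 * y + algebraMap R Q a = 0 := by
    have : Ideal.Quotient.mk I (2 * x + algebraMap R _ a) = 0 :=
      Ideal.Quotient.eq_zero_iff_mem.mpr (Ideal.mem_span_singleton_self _)
    rw [map_add, map_mul, map_ofNat] at this
    exact this
  have h10 : (0 : Q) = 1 := aux_triv R a b h Q y hy hy2
  have hu : IsUnit (2 * x + algebraMap R _ a) := by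
    rw [← Ideal.span_singleton_eq_top]
    exact Ideal.Quotient.subsingleton_iff.mp (subsingleton_of_zero_eq_one h10)
  have hu2 : IsUnit (algebraMap R (AdjoinRoot f) (a ^ 2 - 4 * b)) := by
    have : algebraMap R (AdjoinRoot f) (a ^ 2 - 4 * b) = (2 * x + algebraMap R _ a) ^ 2 := by
      simp only [map_sub, map_mul, map_pow, map_ofNat]
      linear_combination -4 * hx
    rw [this]
    exact hu.pow 2
  have hfin : Module.Finite R (AdjoinRoot f) := (AdjoinRoot.powerBasis' hm).finite
  have hinj : Function.Injective (algebraMap R (AdjoinRoot f)) :=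
by
    rw [injective_iff_map_eq_zero]
    intro r hr
    by_contra hne
    have hd : f ∣ C r := AdjoinRoot.mk_eq_zero.mp hr
    refine hm.not_dvd_of_natDegree_lt (by simpa using hne) ?_ hd
    have : f.natDegree = 2 := by rw [hf]; compute_degree!
    rw [this, natDegree_C]; norm_num
  have := (algebraMap_isIntegral_iff.mpr
    (inferInstance : Algebra.IsIntegral R (AdjoinRoot f))).isLocalHom hinj
  exact isUnit_of_map_unit _ _ hu2

/-- `A = R[x]/⟨x² + ax + b⟩` is étale over `R` (formally étale and of finite
presentation) iff `a² − 4b` is a unit in `R`. -/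
theorem stmt_8 (R : Type*) [CommRing R] (a b : R) :
    Algebra.Etale R (AdjoinRoot (X ^ 2 + C a * X + C b)) ↔ IsUnit (a ^ 2 - 4 * b) := by
  exact ⟨fun _ => aux_forw R a b inferInstance, aux_back R a b⟩
end

section
/- Let R be a commutative ring and a, b, c, d ∈ R. Then there exists an R-algebra isomorphism R[x]/⟨x² + ax + b⟩ ≅ R[x]/⟨x² + cx + d⟩ if and only if there exist a unit w ∈ R and an element v ∈ R such that c = w⁻¹(2v + a) and d = w⁻²(v² + av + b); that is, the isomorphism classes of R-algebras of the form R[x]/⟨x² + ax + b⟩ correspond exactly to the orbits of the right action (a, b) ⋆ (w, v) = (w⁻¹(2v + a), w⁻²(v² + av + b)) of the group R^× ⋉ R on R × R. -/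
open Polynomial

theorem q_monic {R : Type*} [CommRing R] (a b : R) : (X ^ 2 + C a * X + C b : R[X]).Monic := by
  monicity!

theorem q_root {R : Type*} [CommRing R] (a b : R) :
    (AdjoinRoot.root (X ^ 2 + C a * X + C b : R[X])) ^ 2
      + algebraMap R _ a * AdjoinRoot.root (X ^ 2 + C a * X + C b : R[X])
      + algebraMap R _ b = 0 := by
  have h := AdjoinRoot.mk_self (f := (X ^ 2 + C a * X + C b : R[X]))
  rw [map_add, map_add, map_mul, map_pow, AdjoinRoot.mk_X, AdjoinRoot.mk_C, AdjoinRoot.mk_C] at h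
  exact h

theorem q_degree {R : Type*} [CommRing R] [Nontrivial R] (a b : R) :
    (X ^ 2 + C a * X + C b : R[X]).degree = 2 := by
  compute_degree!

theorem q_exists {R : Type*} [CommRing R] [Nontrivial R] (a b : R)
    (z : AdjoinRoot (X ^ 2 + C a * X + C b : R[X])) :
    ∃ p q : R, z = algebraMap R _ p * AdjoinRoot.root (X ^ 2 + C a * X + C b : R[X])
      + algebraMap R _ q := by
  obtain ⟨g, rfl⟩ := AdjoinRoot.mk_surjective z
  have hd := degree_modByMonic_lt g (q_monic a b)
  rw [q_degree] at hd
  have hd' : (g %ₘ (X ^ 2 + C a * X + C b)).degree ≤ 1 := Order.le_of_lt_succ hd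
  have he := eq_X_add_C_of_degree_le_one hd'
  have h1 : AdjoinRoot.mk (X ^ 2 + C a * X + C b) g
      = AdjoinRoot.mk (X ^ 2 + C a * X + C b) (g %ₘ (X ^ 2 + C a * X + C b)) := by
    conv_lhs => rw [← modByMonic_add_div g (X ^ 2 + C a * X + C b)]
    rw [map_add, map_mul, AdjoinRoot.mk_self, zero_mul, add_zero]
  have h2 := h1.trans (congrArg (AdjoinRoot.mk (X ^ 2 + C a * X + C b)) he)
  rw [map_add, map_mul, AdjoinRoot.mk_X, AdjoinRoot.mk_C, AdjoinRoot.mk_C] at h2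
  exact ⟨_, _, h2⟩

theorem q_unique {R : Type*} [CommRing R] [Nontrivial R] (a b p q : R)
    (h : algebraMap R _ p * AdjoinRoot.root (X ^ 2 + C a * X + C b : R[X])
      + algebraMap R _ q = 0) : p = 0 ∧ q = 0 := by
  have h1 : AdjoinRoot.mk (X ^ 2 + C a * X + C b) (C p * X + C q) = 0 := by
    rw [map_add, map_mul, AdjoinRoot.mk_X, AdjoinRoot.mk_C, AdjoinRoot.mk_C]
    exact h
  rw [AdjoinRoot.mk_eq_zero] at h1
  have h2 : (C p * X + C q : R[X]) = 0 := by
    by_contra hne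
    refine (q_monic a b).not_dvd_of_degree_lt hne ?_ h1
    rw [q_degree]
    exact degree_linear_lt
  constructor
  · simpa using congrArg (fun g => coeff g 1) h2
  · simpa using congrArg (fun g => coeff g 0) h2

/-- For `a, b, c, d ∈ R`, there is an `R`-algebra isomorphism
`R[x]/⟨x² + ax + b⟩ ≅ R[x]/⟨x² + cx + d⟩` iff there exist a unit `w ∈ R` and `v ∈ R`
with `c = w⁻¹(2v + a)` and `d = w⁻²(v² + av + b)`; i.e. the isomorphism classes of
such algebras are exactly the orbits of the right action
`(a, b) ⋆ (w, v) = (w⁻¹(2v + a), w⁻²(v² + av + b))` of `R^× ⋉ R` on `R × R`. -/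
theorem stmt_19 (R : Type*) [CommRing R] (a b c d : R) :
    Nonempty (AdjoinRoot (X ^ 2 + C a * X + C b) ≃ₐ[R] AdjoinRoot (X ^ 2 + C c * X + C d)) ↔
      ∃ (w : Rˣ) (v : R),
        c = (↑w⁻¹ : R) * (2 * v + a) ∧ d = (↑w⁻¹ : R) ^ 2 * (v ^ 2 + a * v + b) := by
  constructor
  · rintro ⟨φ⟩
    rcases subsingleton_or_nontrivial R with hs | hn
    · exact ⟨1, 0, Subsingleton.elim _ _, Subsingleton.elim _ _⟩
    obtain ⟨w, v, h1⟩ := q_exists c d (φ (AdjoinRoot.root _))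
    obtain ⟨w', v', h2⟩ := q_exists a b (φ.symm (AdjoinRoot.root _))
    have h3 := congrArg φ.symm h1
    rw [φ.symm_apply_apply, map_add, map_mul, h2, AlgEquiv.commutes, AlgEquiv.commutes] at h3
    have h4 := q_unique a b (w * w' - 1) (w * v' + v) (by
      simp only [map_sub, map_mul, map_add, map_one]
      linear_combination -h3)
    have hr := congrArg φ (q_root a b)
    rw [map_add, map_add, map_mul, map_pow, h1, AlgEquiv.commutes, AlgEquiv.commutes, map_zero] at hr
    have h5 := q_unique c d (-w ^ 2 * c + 2 * w * v + a * w) (-w ^ 2 * d + v ^ 2 + a * v + b) (by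
      simp only [map_neg, map_mul, map_add, map_pow, map_ofNat]
      linear_combination hr - (algebraMap R _ w) ^ 2 * q_root c d)
    have hw : w * w' = 1 := by linear_combination h4.1
    refine ⟨⟨w, w', hw, by rw [mul_comm, hw]⟩, v, ?_, ?_⟩
    · change c = w' * _
      linear_combination (-(w' ^ 2)) * h5.1 + (- c * (w * w' + 1) + w' * (2 * v + a)) * hw
    · change d = w' ^ 2 * _
      linear_combination (-(w' ^ 2)) * h5.2 - d * (w * w' + 1) * hw
  · rintro ⟨w, v, hc, hd⟩
    have hw : (w : R) * (↑w⁻¹ : R) = 1 := w.mul_inv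
    generalize (↑w⁻¹ : R) = u at *
    generalize (w : R) = w at *
    have hB := q_root c d
    have hA := q_root a b
    have e1 : w ^ 2 * c = w * (2 * v + a) := by
      rw [hc]; linear_combination w * (2 * v + a) * hw
    have e2 : w ^ 2 * d = v ^ 2 + a * v + b := by
      rw [hd]; linear_combination (v ^ 2 + a * v + b) * (w * u + 1) * hw
    let f : AdjoinRoot (X ^ 2 + C a * X + C b) →ₐ[R] AdjoinRoot (X ^ 2 + C c * X + C d) :=
      AdjoinRoot.liftAlgHom _ (Algebra.ofId _ _)
        (algebraMap R _ w * AdjoinRoot.root _ + algebraMap R _ v) (by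
        simp only [eval₂_add, eval₂_mul, eval₂_pow, eval₂_X, eval₂_C]
        have E1 := congrArg (algebraMap R (AdjoinRoot (X ^ 2 + C c * X + C d))) e1
        have E2 := congrArg (algebraMap R (AdjoinRoot (X ^ 2 + C c * X + C d))) e2
        simp only [map_mul, map_add, map_pow, map_ofNat] at E1 E2
        change _ + algebraMap R _ a * _ + algebraMap R _ b = 0
        linear_combination (algebraMap R _ w) ^ 2 * hB - AdjoinRoot.root _ * E1 - E2)
    let g : AdjoinRoot (X ^ 2 + C c * X + C d) →ₐ[R] AdjoinRoot (X ^ 2 + C a * X + C b) :=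
      AdjoinRoot.liftAlgHom _ (Algebra.ofId _ _)
        (algebraMap R _ u * (AdjoinRoot.root _ - algebraMap R _ v)) (by
        simp only [eval₂_add, eval₂_mul, eval₂_pow, eval₂_X, eval₂_C]
        have E1 := congrArg (algebraMap R (AdjoinRoot (X ^ 2 + C a * X + C b))) hc
        have E2 := congrArg (algebraMap R (AdjoinRoot (X ^ 2 + C a * X + C b))) hd
        simp only [map_mul, map_add, map_pow, map_ofNat] at E1 E2
        change _ + algebraMap R _ c * _ + algebraMap R _ d = 0
        rw [E1, E2]
        linear_combination (algebraMap R _ u) ^ 2 * hA)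
    have hf : f (AdjoinRoot.root _) = algebraMap R _ w * AdjoinRoot.root _ + algebraMap R _ v :=
      AdjoinRoot.liftAlgHom_root ..
    have hg : g (AdjoinRoot.root _) = algebraMap R _ u * (AdjoinRoot.root _ - algebraMap R _ v) :=
      AdjoinRoot.liftAlgHom_root ..
    refine ⟨AlgEquiv.ofAlgHom f g ?_ ?_⟩
    · apply AdjoinRoot.algHom_ext
      have E := congrArg (algebraMap R (AdjoinRoot (X ^ 2 + C c * X + C d))) hw
      simp only [map_mul, map_one] at E
      rw [AlgHom.comp_apply, hg, map_mul, map_sub, hf, AlgHom.commutes, AlgHom.commutes,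
        AlgHom.id_apply]
      linear_combination AdjoinRoot.root _ * E
    · apply AdjoinRoot.algHom_ext
      have E := congrArg (algebraMap R (AdjoinRoot (X ^ 2 + C a * X + C b))) hw
      simp only [map_mul, map_one] at E
      rw [AlgHom.comp_apply, hf, map_add, map_mul, hg, AlgHom.commutes, AlgHom.commutes,
        AlgHom.id_apply]
      linear_combination (AdjoinRoot.root _ - algebraMap R _ v) * E
end
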